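/- There exist a locally finite connected graph G, an end ε of G, and pairwise distinct ends ε_n (n ∈ ℕ) of G, each distinct from ε, such that for every tree-decomposition (T, (V_t)) of G there is some n ∈ ℕ for which (T, (V_t)) does not distinguish ε_n and ε efficiently. -/

import Mathlib

open SimpleGraph

universe u v

section CommonDefs

variable {V : Type u} {N : Type v}

/-- `u` and `w` are joined by a walk in `G` all of whose vertices avoid `X`,
i.e. they lie in the same component of `G - X`. -/
def ConnAvoiding (G : SimpleGraph V) (X : Set V) (u w : V) : Prop :=
  ∃ p : G.Walk u w, ∀ x ∈ p.support, x ∉ X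

/-- `r` is a (one-way infinite) ray in `G`. -/
def IsRay (G : SimpleGraph V) (r : ℕ → V) : Prop :=
  Function.Injective r ∧ ∀ n : ℕ, G.Adj (r n) (r (n + 1))

/-- Two rays are equivalent (i.e. belong to the same end) if for every finite vertex set `X`
they have tails in the same component of `G - X`. -/
def RayEquiv (G : SimpleGraph V) (r r' : ℕ → V) : Prop :=
  ∀ X : Set V, X.Finite → ∃ M : ℕ, ∀ m ≥ M, ∀ n ≥ M, ConnAvoiding G X (r m) (r' n)

/-- `v` lies in the component `C_G(X, ε)` of `G - X` containing a tail of the ray `r`. -/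
def InEndComp (G : SimpleGraph V) (X : Set V) (r : ℕ → V) (v : V) : Prop :=
  ∃ M : ℕ, ∀ n ≥ M, ConnAvoiding G X v (r n)

/-- `v` dominates the end of the ray `r`. -/
def Dominates (G : SimpleGraph V) (r : ℕ → V) (v : V) : Prop :=
  ∀ X : Set V, X.Finite → v ∉ X → InEndComp G X r v

/-- `Dom(ε)` for the end `ε` of the ray `r`. -/
def DomSet (G : SimpleGraph V) (r : ℕ → V) : Set V := {v | Dominates G r v}

/-- There are `n` pairwise (vertex-)disjoint rays belonging to the end of `r`. -/
def HasDisjRays (G : SimpleGraph V) (r : ℕ → V) (n : ℕ) : Prop :=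
  ∃ f : Fin n → ℕ → V, (∀ i, IsRay G (f i)) ∧ (∀ i, RayEquiv G r (f i)) ∧
    Pairwise fun i j => ∀ k l : ℕ, f i k ≠ f j l

/-- The degree of the end of `r`, as an extended natural number. -/
noncomputable def EndDegree (G : SimpleGraph V) (r : ℕ → V) : ℕ∞ :=
  ⨆ (n : ℕ) (_ : HasDisjRays G r n), (n : ℕ∞)

/-- A family of pairwise disjoint `A`–`B` paths indexed by `ι`. -/
def DisjointPathsFam (G : SimpleGraph V) (A B : Set V) (ι : Type*) : Prop :=
  ∃ (a b : ι → V) (p : ∀ i : ι, G.Walk (a i) (b i)),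
    (∀ i, (p i).IsPath) ∧ (∀ i, a i ∈ A) ∧ (∀ i, b i ∈ B) ∧
    Pairwise fun i j => ∀ x ∈ (p i).support, x ∉ (p j).support

/-- There are `n` pairwise disjoint `A`–`B` paths in `G`. -/
def DisjointPaths (G : SimpleGraph V) (A B : Set V) (n : ℕ) : Prop :=
  DisjointPathsFam G A B (Fin n)

/-- `C` is (the vertex set of) a connected component of the subgraph of `G` induced on `S`. -/
def IsCompOf (G : SimpleGraph V) (S C : Set V) : Prop :=
  C.Nonempty ∧ C ⊆ S ∧ (G.induce C).Connected ∧
    ∀ u ∈ C, ∀ v ∈ S, G.Adj u v → v ∈ C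

/-- The neighbourhood `N_G(C)` of the set `C` in `G`. -/
def NbhdSet (G : SimpleGraph V) (C : Set V) : Set V :=
  {v | v ∉ C ∧ ∃ u ∈ C, G.Adj u v}

/-- A graph is locally finite if every vertex has finite degree. -/
def LocFin (G : SimpleGraph V) : Prop := ∀ v : V, {w : V | G.Adj v w}.Finite

/-- A tree-decomposition of `G` with decomposition tree `T`. -/
structure TreeDecomp (G : SimpleGraph V) (T : SimpleGraph N) : Type (max u v) where
  isTree : T.IsTree
  bag : N → Set V
  bag_cover : ∀ v : V, ∃ t : N, v ∈ bag t
  bag_edge : ∀ ⦃x y : V⦄, G.Adj x y → ∃ t : N, x ∈ bag t ∧ y ∈ bag t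
  bag_conn : ∀ (v : V) {s t : N} (p : T.Walk s t), p.IsPath →
    v ∈ bag s → v ∈ bag t → ∀ x ∈ p.support, v ∈ bag x

namespace TreeDecomp

variable {G : SimpleGraph V} {T : SimpleGraph N}

/-- The unique path in the tree `T` from `s` to `t`. -/
noncomputable def path (D : TreeDecomp G T) (s t : N) : T.Walk s t :=
  (D.isTree.existsUnique_path s t).choose

/-- The adhesion set of the edge `ab` of `T`. -/
def adh (D : TreeDecomp G T) (a b : N) : Set V := D.bag a ∩ D.bag b

/-- `ab` is an edge of `T` lying on the path from `s` to `t`. -/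
def EdgeOnPath (D : TreeDecomp G T) (s t a b : N) : Prop :=
  T.Adj a b ∧ s(a, b) ∈ (D.path s t).edges

/-- All bags are finite. -/
def FiniteParts (D : TreeDecomp G T) : Prop := ∀ t : N, (D.bag t).Finite

/-- The tree-decomposition is lean. -/
def IsLean (D : TreeDecomp G T) : Prop :=
  ∀ (s t : N) (Zs Zt : Finset V), ↑Zs ⊆ D.bag s → ↑Zt ⊆ D.bag t →
    Zs.card = Zt.card →
    DisjointPaths G ↑Zs ↑Zt Zs.card ∨
      ∃ a b : N, D.EdgeOnPath s t a b ∧ (D.adh a b).encard < (Zs.card : ℕ∞)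

/-- The tree-decomposition is strongly linked: for all nodes `s ≠ t` there are
`min {|V_e| : e ∈ E(sTt)}` pairwise disjoint `V_s`–`V_t` paths. -/
def StronglyLinked (D : TreeDecomp G T) : Prop :=
  ∀ s t : N, s ≠ t →
    ∃ c : Cardinal.{u},
      (∀ a b : N, D.EdgeOnPath s t a b → c ≤ Cardinal.mk ↥(D.adh a b)) ∧
      (∃ a b : N, D.EdgeOnPath s t a b ∧ c = Cardinal.mk ↥(D.adh a b)) ∧
      ∃ ι : Type u, Cardinal.mk ι = c ∧ DisjointPathsFam G (D.bag s) (D.bag t) ι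

/-- One side of the separation of `G` induced by the edge `ab` of `T`: the union of the
bags over all nodes in the component of `T - ab` containing `a`. -/
def sideSet (D : TreeDecomp G T) (a b : N) : Set V :=
  ⋃ x ∈ {x : N | b ∉ (D.path a x).support}, D.bag x

end TreeDecomp

/-- A rooted tree-decomposition. -/
structure RootedTreeDecomp (G : SimpleGraph V) (T : SimpleGraph N)
    extends TreeDecomp G T : Type (max u v) where
  root : N

namespace RootedTreeDecomp

variable {G : SimpleGraph V} {T : SimpleGraph N}

/-- The tree-order on `T` induced by the root: `s ≤ t` iff `s` lies on the path
from the root to `t`. -/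
def le (D : RootedTreeDecomp G T) (s t : N) : Prop :=
  s ∈ (D.toTreeDecomp.path D.root t).support

/-- `st` is an edge of `T` with `s < t` in the tree-order. -/
def IsOrientedEdge (D : RootedTreeDecomp G T) (s t : N) : Prop :=
  T.Adj s t ∧ D.le s t

/-- The vertex set of `G↑e` for the oriented edge `e = st`: the union of the bags over
all nodes of the component `T_e` of `T - e` not containing the root. -/
def above (D : RootedTreeDecomp G T) (t : N) : Set V :=
  ⋃ x ∈ {x : N | D.le t x}, D.bag x

/-- The vertex set of `G∘↑e` (the part strictly above `e`) for the oriented edge `e = st`. -/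
def strictAbove (D : RootedTreeDecomp G T) (s t : N) : Set V :=
  D.above t \ (D.bag s ∩ D.bag t)

/-- The rooted tree-decomposition is componental. -/
def Componental (D : RootedTreeDecomp G T) : Prop :=
  ∀ s t : N, D.IsOrientedEdge s t → (G.induce (D.strictAbove s t)).Connected

/-- The rooted tree-decomposition is tight. -/
def Tight (D : RootedTreeDecomp G T) : Prop :=
  ∀ s t : N, D.IsOrientedEdge s t →
    ∃ C : Set V, IsCompOf G (D.strictAbove s t) C ∧ NbhdSet G C = D.bag s ∩ D.bag t

/-- The rooted tree-decomposition is linked: for all comparable nodes `s < t` there are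
`min {|V_e| : e ∈ E(sTt)}` pairwise disjoint `V_s`–`V_t` paths. -/
def Linked (D : RootedTreeDecomp G T) : Prop :=
  ∀ s t : N, D.le s t → s ≠ t →
    ∃ c : Cardinal.{u},
      (∀ a b : N, D.toTreeDecomp.EdgeOnPath s t a b →
        c ≤ Cardinal.mk ↥(D.bag a ∩ D.bag b)) ∧
      (∃ a b : N, D.toTreeDecomp.EdgeOnPath s t a b ∧
        c = Cardinal.mk ↥(D.bag a ∩ D.bag b)) ∧
      ∃ ι : Type u, Cardinal.mk ι = c ∧ DisjointPathsFam G (D.bag s) (D.bag t) ι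

/-- A rooted ray of `T`, i.e. a ray starting at the root. -/
def IsRootedRay (D : RootedTreeDecomp G T) (ρ : ℕ → N) : Prop :=
  IsRay T ρ ∧ ρ 0 = D.root

/-- `liminf_{e ∈ E(R)} V_e`: the vertices lying in `V_e` for all but finitely many
edges `e` of the ray `R = ρ`. -/
def bagLiminf (D : RootedTreeDecomp G T) (ρ : ℕ → N) : Set V :=
  {v | ∃ M : ℕ, ∀ n ≥ M, v ∈ D.bag (ρ n) ∩ D.bag (ρ (n + 1))}

/-- `liminf_{e ∈ E(R)} |V_e|` for the ray `R = ρ`. -/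
noncomputable def adhLiminf (D : RootedTreeDecomp G T) (ρ : ℕ → N) : ℕ∞ :=
  Filter.liminf (fun n : ℕ => (D.bag (ρ n) ∩ D.bag (ρ (n + 1))).encard) Filter.atTop

/-- The end of the ray `r` of `G` gives rise to the rooted ray `ρ` of `T`: every ray
equivalent to `r` meets every bag along `ρ` only finitely often, and for every edge
`e = st` of `ρ` the component `C_G(V_s, ε)` is contained in `G∘↑e`. -/
def GivesRise (D : RootedTreeDecomp G T) (r : ℕ → V) (ρ : ℕ → N) : Prop :=
  D.IsRootedRay ρ ∧
  (∀ r' : ℕ → V, IsRay G r' → RayEquiv G r r' →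
    ∀ n : ℕ, {k : ℕ | r' k ∈ D.bag (ρ n)}.Finite) ∧
  (∀ (n : ℕ) (v : V), InEndComp G (D.bag (ρ n)) r v →
    v ∈ D.strictAbove (ρ n) (ρ (n + 1)))

end RootedTreeDecomp

/-- `{A, B}` is a separation of `G`. -/
def IsSeparation (G : SimpleGraph V) (A B : Set V) : Prop :=
  A ∪ B = Set.univ ∧ ∀ a ∈ A \ B, ∀ b ∈ B \ A, ¬ G.Adj a b

/-- The separation `{A, B}` separates the ends of `r` and `r'`: they live in components of
`G - (A ∩ B)` contained in different sides of `{A, B}`. -/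
def SepSeparatesEnds (G : SimpleGraph V) (A B : Set V) (r r' : ℕ → V) : Prop :=
  ((∀ v, InEndComp G (A ∩ B) r v → v ∈ A \ B) ∧
    (∀ v, InEndComp G (A ∩ B) r' v → v ∈ B \ A)) ∨
  ((∀ v, InEndComp G (A ∩ B) r v → v ∈ B \ A) ∧
    (∀ v, InEndComp G (A ∩ B) r' v → v ∈ A \ B))

/-- The separation `{A, B}` efficiently distinguishes the ends of `r` and `r'`. -/
def EffDistinguishes (G : SimpleGraph V) (A B : Set V) (r r' : ℕ → V) : Prop :=
  IsSeparation G A B ∧ SepSeparatesEnds G A B r r' ∧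
    ∀ A' B' : Set V, IsSeparation G A' B' → SepSeparatesEnds G A' B' r r' →
      (A ∩ B).encard ≤ (A' ∩ B').encard

/-- The tree-decomposition `D` distinguishes the ends of `r` and `r'` efficiently. -/
def TreeDecomp.EffDistinguishesEnds {G : SimpleGraph V} {T : SimpleGraph N}
    (D : TreeDecomp G T) (r r' : ℕ → V) : Prop :=
  ∃ a b : N, T.Adj a b ∧ EffDistinguishes G (D.sideSet a b) (D.sideSet b a) r r'

/-- `G` contains `H` as a minor. -/
def HasMinor {W : Type v} (G : SimpleGraph V) (H : SimpleGraph W) : Prop :=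
  ∃ B : W → Set V, (∀ h, (B h).Nonempty) ∧ (∀ h, (G.induce (B h)).Connected) ∧
    (Pairwise fun h h' => Disjoint (B h) (B h')) ∧
    ∀ ⦃h h'⦄, H.Adj h h' → ∃ u ∈ B h, ∃ w ∈ B h', G.Adj u w

/-- The half-grid: the graph on `ℕ × ℤ` in which `(i, j)` and `(i', j')` are adjacent
iff `|i - i'| + |j - j'| = 1`. -/
def halfGrid : SimpleGraph (ℕ × ℤ) :=
  SimpleGraph.fromRel fun p q =>
    ((p.1 : ℤ) - (q.1 : ℤ)).natAbs + (p.2 - q.2).natAbs = 1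

/-- The one-way infinite path on `ℕ`. -/
def natRayGraph : SimpleGraph ℕ :=
  SimpleGraph.fromRel fun m n => n = m + 1

/-- The path on `m` vertices. -/
def finPathGraph (m : ℕ) : SimpleGraph (Fin m) :=
  SimpleGraph.fromRel fun i j => (j : ℕ) = (i : ℕ) + 1

/-- The strong product of two graphs. -/
def strongProd {W : Type v} (G : SimpleGraph V) (H : SimpleGraph W) : SimpleGraph (V × W) :=
  SimpleGraph.fromRel fun x y =>
    (x.1 = y.1 ∨ G.Adj x.1 y.1) ∧ (x.2 = y.2 ∨ H.Adj x.2 y.2)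

end CommonDefs

section Separations

variable {V : Type u} {G : SimpleGraph V} {X A B : Set V} {x y z : V}

theorem ConnAvoiding.refl (h : x ∉ X) : ConnAvoiding G X x x :=
  ⟨.nil, by simpa using h⟩

theorem ConnAvoiding.symm (h : ConnAvoiding G X x y) : ConnAvoiding G X y x := by
  obtain ⟨p, hp⟩ := h
  exact ⟨p.reverse, by simpa using hp⟩

theorem ConnAvoiding.trans (h : ConnAvoiding G X x y) (h' : ConnAvoiding G X y z) :
    ConnAvoiding G X x z := by
  obtain ⟨p, hp⟩ := h
  obtain ⟨q, hq⟩ := h'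
  refine ⟨p.append q, fun w hw => ?_⟩
  rcases (Walk.mem_support_append_iff p q).1 hw with h | h
  exacts [hp w h, hq w h]

theorem ConnAvoiding.of_adj (h : G.Adj x y) (hx : x ∉ X) (hy : y ∉ X) :
    ConnAvoiding G X x y :=
  ⟨h.toWalk, by simp [hx, hy]⟩

theorem ConnAvoiding.right_notMem (h : ConnAvoiding G X x y) : y ∉ X := by
  obtain ⟨p, hp⟩ := h
  exact hp y p.end_mem_support

theorem IsSeparation.symm (h : IsSeparation G A B) : IsSeparation G B A :=
  ⟨by rw [Set.union_comm]; exact h.1, fun a ha b hb hab => h.2 b hb a ha hab.symm⟩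

/-- A walk avoiding the separator does not leave a side of a separation. -/
theorem IsSeparation.mem_diff_of_connAvoiding (hs : IsSeparation G A B)
    (h : ConnAvoiding G (A ∩ B) x y) (hx : x ∈ A \ B) : y ∈ A \ B := by
  obtain ⟨p, hp⟩ := h
  induction p with
  | nil => exact hx
  | @cons a b c hab p ih =>
    refine ih ?_ fun w hw => hp w (by simp [hw])
    have hb : b ∉ A ∩ B := hp b (by simp)
    have hu : b ∈ A ∪ B := hs.1 ▸ Set.mem_univ b
    by_contra hba
    have hb' : b ∈ B \ A := by
      simp only [Set.mem_inter_iff, Set.mem_union, Set.mem_sdiff] at *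
      tauto
    exact hs.2 a hx b hb' hab

theorem not_connAvoiding_of_mem_diff (hs : IsSeparation G A B) (hx : x ∈ A \ B)
    (hy : y ∈ B \ A) : ¬ ConnAvoiding G (A ∩ B) x y :=
  fun h => hy.2 (hs.mem_diff_of_connAvoiding h hx).1

theorem not_rayEquiv_of_isSeparation {r r' : ℕ → V} (hs : IsSeparation G A B)
    (hfin : (A ∩ B).Finite) (hr : ∀ᶠ k in Filter.atTop, r k ∈ A \ B)
    (hr' : ∀ᶠ k in Filter.atTop, r' k ∈ B \ A) : ¬ RayEquiv G r r' := by
  intro h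
  obtain ⟨M, hM⟩ := h _ hfin
  obtain ⟨i, hi, hMi⟩ := (hr.and (Filter.eventually_ge_atTop M)).exists
  obtain ⟨j, hj, hMj⟩ := (hr'.and (Filter.eventually_ge_atTop M)).exists
  exact not_connAvoiding_of_mem_diff hs hi hj (hM i hMi j hMj)

theorem RayEquiv.symm {r r' : ℕ → V} (h : RayEquiv G r r') : RayEquiv G r' r := by
  intro X hX
  obtain ⟨M, hM⟩ := h X hX
  exact ⟨M, fun m hm n hn => (hM n hn m hm).symm⟩

theorem IsSeparation.mem_diff_of_inEndComp {r : ℕ → V} (hs : IsSeparation G A B)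
    (hr : ∀ᶠ k in Filter.atTop, r k ∈ A \ B) (h : InEndComp G (A ∩ B) r x) : x ∈ A \ B := by
  obtain ⟨M, hM⟩ := h
  obtain ⟨i, hi, hMi⟩ := (hr.and (Filter.eventually_ge_atTop M)).exists
  exact hs.mem_diff_of_connAvoiding (hM i hMi).symm hi

end Separations

section TreeEdges

variable {V : Type u} {N : Type v} {G : SimpleGraph V} {T : SimpleGraph N}

theorem TreeDecomp.mem_support_path_of_notMem_sideSet (D : TreeDecomp G T) {a b t : N} {x : V}
    (hx : x ∉ D.sideSet a b) (ht : x ∈ D.bag t) : b ∈ (D.path a t).support := by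
  by_contra h
  exact hx (Set.mem_biUnion (x := t) h ht)

theorem TreeDecomp.exists_walk_notMem_support (D : TreeDecomp G T) {a b t : N} (hab : a ≠ b)
    (h : a ∈ (D.path b t).support) : ∃ p : T.Walk a t, s(a, b) ∉ p.edges := by
  classical
  have hp : (D.path b t).IsPath := (D.isTree.existsUnique_path b t).choose_spec.1
  refine ⟨(D.path b t).dropUntil a h, fun he => ?_⟩
  rw [← (D.path b t).take_spec h] at hp
  have hb := Walk.snd_mem_support_of_mem_edges _ he
  rw [Walk.mem_support_iff] at hb
  have hnodup := hp.support_nodup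
  rw [Walk.support_append] at hnodup
  exact List.disjoint_of_nodup_append hnodup (Walk.start_mem_support _)
    (hb.resolve_left hab.symm)

/-- An edge of the tree whose separation has `x` and `y` strictly on different sides lies on the
path between any two bags containing `x` and `y`. -/
theorem TreeDecomp.mem_edges_path (D : TreeDecomp G T) {a b s t : N} {x y : V} (hab : T.Adj a b)
    (hx : x ∉ D.sideSet b a) (hs : x ∈ D.bag s) (hy : y ∉ D.sideSet a b) (ht : y ∈ D.bag t) :
    s(a, b) ∈ (D.path s t).edges := by
  obtain ⟨p, hp⟩ := D.exists_walk_notMem_support hab.ne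
    (D.mem_support_path_of_notMem_sideSet hx hs)
  obtain ⟨q, hq⟩ := D.exists_walk_notMem_support hab.ne'
    (D.mem_support_path_of_notMem_sideSet hy ht)
  by_contra h
  have hbr := isAcyclic_iff_forall_adj_isBridge.1 D.isTree.isAcyclic hab
  have := isBridge_iff_forall_walk_mem_edges.1 hbr ((p.append (D.path s t)).append q.reverse)
  rw [Sym2.eq_swap] at hq
  simp [hp, hq, h] at this

end TreeEdges

namespace BlobGraph

/-- The vertex in the given part, row and column. -/
def pt (p k c : ℕ) : ℕ := Nat.pair p (Nat.pair k c)

def part (x : ℕ) : ℕ := x.unpair.1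

def row (x : ℕ) : ℕ := x.unpair.2.unpair.1

def col (x : ℕ) : ℕ := x.unpair.2.unpair.2

@[simp] theorem part_pt (p k c : ℕ) : part (pt p k c) = p := by simp [part, pt]

@[simp] theorem row_pt (p k c : ℕ) : row (pt p k c) = k := by simp [row, pt]

@[simp] theorem col_pt (p k c : ℕ) : col (pt p k c) = c := by simp [col, pt]

@[simp] theorem pt_part_row_col (x : ℕ) : pt (part x) (row x) (col x) = x := by
  simp [pt, part, row, col]

theorem pt_inj {p k c p' k' c' : ℕ} :
    pt p k c = pt p' k' c' ↔ p = p' ∧ k = k' ∧ c = c' := by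
  simp [pt, Nat.pair_eq_pair]

/-- Each part is a blob in which consecutive (finite) levels `row + col` are completely joined.
Part `m + 1` is joined to part `m + 2` by a matching of `2 ^ (m + 1)` edges from odd to even
columns, and to part `0` by a matching of `2 ^ m` edges. -/
def Rel (x y : ℕ) : Prop :=
  (part x = part y ∧ row x + col x ≤ row y + col y + 1 ∧ row y + col y ≤ row x + col x + 1) ∨
  (row x = 0 ∧ row y = 0 ∧ ∃ m c,
    (part x = m + 1 ∧ part y = m + 2 ∧ col x = 2 * c + 1 ∧ col y = 2 * c ∧ c < 2 ^ (m + 1)) ∨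
    (part x = m + 1 ∧ part y = 0 ∧ col x = 2 * c ∧ col y = c ∧ 2 ^ m ≤ c ∧ c < 2 ^ (m + 1)))

def graph : SimpleGraph ℕ := SimpleGraph.fromRel Rel

/-- The ray in the first column of part `p`. -/
def ray (p k : ℕ) : ℕ := pt p k 0

theorem adj_of_level {p k c k' c' : ℕ} (hne : ¬ (k = k' ∧ c = c'))
    (h : k + c ≤ k' + c' + 1) (h' : k' + c' ≤ k + c + 1) :
    graph.Adj (pt p k c) (pt p k' c') := by
  refine ⟨fun he => hne (pt_inj.1 he).2, Or.inl (Or.inl ?_)⟩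
  simp [h, h']

theorem adj_next {m c : ℕ} (h : c < 2 ^ (m + 1)) :
    graph.Adj (pt (m + 1) 0 (2 * c + 1)) (pt (m + 2) 0 (2 * c)) := by
  refine ⟨fun he => by simp [pt_inj] at he, Or.inl (Or.inr ?_)⟩
  simp [h]

theorem adj_zero {m c : ℕ} (h : 2 ^ m ≤ c) (h' : c < 2 ^ (m + 1)) :
    graph.Adj (pt (m + 1) 0 (2 * c)) (pt 0 0 c) := by
  refine ⟨fun he => by simp [pt_inj] at he, Or.inl (Or.inr ⟨?_, ?_, m, c, Or.inr ?_⟩)⟩ <;>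
  simp [h, h']

theorem locFin_graph : LocFin graph := by
  intro x
  refine (((Set.finite_Iic (part x + col x + 2)).prod ((Set.finite_Iic (row x + col x + 1)).prod
    (Set.finite_Iic (row x + 2 * col x + 1)))).image fun q => pt q.1 q.2.1 q.2.2).subset ?_
  intro y hy
  refine ⟨(part y, row y, col y), ?_, pt_part_row_col y⟩
  have hlt (m : ℕ) : m < 2 ^ m := Nat.lt_two_pow_self
  simp only [Set.mem_prod, Set.mem_Iic]
  rcases hy.2 with (h | ⟨h1, h2, m, c, h⟩) | (h | ⟨h1, h2, m, c, h⟩) <;> grind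

theorem isRay_ray (p : ℕ) : IsRay graph (ray p) :=
  ⟨fun k k' h => (pt_inj.1 h).2.1, fun k => adj_of_level (by omega) (by omega) (by omega)⟩

section Paths

variable {X : Set ℕ} {p c : ℕ}

theorem connAvoiding_column (hX : ∀ k, pt p k c ∉ X) (k k' : ℕ) :
    ConnAvoiding graph X (pt p k c) (pt p k' c) := by
  have h0 : ∀ k, ConnAvoiding graph X (pt p 0 c) (pt p k c) := by
    intro k
    induction k with
    | zero => exact .refl (hX 0)
    | succ k ih =>
      exact ih.trans (.of_adj (adj_of_level (by omega) (by omega) (by omega)) (hX _) (hX _))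
  exact (h0 k).symm.trans (h0 k')

theorem inEndComp_column (hfin : X.Finite) (hX : ∀ k, pt p k c ∉ X) :
    InEndComp graph X (ray p) (pt p 0 c) := by
  obtain ⟨M, hM⟩ : ∃ M, ∀ k ≥ M, ray p k ∉ X := by
    obtain ⟨M, hM⟩ := (hfin.preimage (isRay_ray p).1.injOn).bddAbove
    exact ⟨M + 1, fun k hk hkX => by have := hM hkX; omega⟩
  refine ⟨M + c, fun n hn => (connAvoiding_column hX 0 (n - c)).trans ?_⟩
  by_cases hc : c = 0
  · subst hc
    exact .refl (hX n)
  · exact .of_adj (adj_of_level (by omega) (by omega) (by omega)) (hX _) (hM n (by omega))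

end Paths

theorem connected_graph : graph.Connected := by
  have hcol (p c k k' : ℕ) : graph.Reachable (pt p k c) (pt p k' c) :=
    (connAvoiding_column (X := ∅) (by simp) k k').elim fun w _ => w.reachable
  have hpart (p k c : ℕ) : graph.Reachable (pt p k c) (pt p 0 0) := by
    refine (hcol p c k 0).trans (.trans ?_ (hcol p 0 c 0))
    by_cases hc : c = 0
    · rw [hc]
    · exact (adj_of_level (by omega) (by omega) (by omega)).reachable
  have hzero (x : ℕ) : graph.Reachable x (pt 0 0 0) := by
    rw [← pt_part_row_col x]
    obtain h | ⟨m, h⟩ : part x = 0 ∨ ∃ m, part x = m + 1 := by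
      cases part x <;> simp
    · rw [h]; exact hpart _ _ _
    · rw [h]
      refine (hpart _ _ _).trans ((hpart _ 0 (2 * 2 ^ m)).symm.trans
        (.trans ?_ (hpart 0 0 (2 ^ m))))
      exact (adj_zero le_rfl (Nat.pow_lt_pow_right one_lt_two m.lt_succ_self)).reachable
  have : Nonempty ℕ := ⟨0⟩
  exact ⟨fun x y => (hzero x).trans (hzero y).symm⟩

section Cut

/-- A smallest set separating part `n + 1` from part `0`. -/
def cut (n : ℕ) : Finset ℕ :=
  (Finset.range (2 ^ (n + 1))).image (fun c => pt (n + 1) 0 (2 * c + 1)) ∪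
    (Finset.Ico 1 (2 ^ (n + 1))).image (pt 0 0)

def cutLeft (n : ℕ) : Set ℕ := {x | 1 ≤ part x ∧ part x ≤ n + 1} ∪ cut n

def cutRight (n : ℕ) : Set ℕ := {x | 1 ≤ part x ∧ part x ≤ n + 1}ᶜ ∪ cut n

theorem cutLeft_inter_cutRight (n : ℕ) : cutLeft n ∩ cutRight n = cut n := by
  rw [cutLeft, cutRight, ← Set.inter_union_distrib_right, Set.inter_compl_self, Set.empty_union]

theorem card_cut_lt (n : ℕ) : (cut n).card < 2 ^ (n + 2) := by
  have h1 := Finset.card_union_le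
    ((Finset.range (2 ^ (n + 1))).image (fun c => pt (n + 1) 0 (2 * c + 1)))
    ((Finset.Ico 1 (2 ^ (n + 1))).image (pt 0 0))
  have h2 := Finset.card_image_le (s := Finset.range (2 ^ (n + 1)))
    (f := fun c => pt (n + 1) 0 (2 * c + 1))
  have h3 := Finset.card_image_le (s := Finset.Ico 1 (2 ^ (n + 1))) (f := pt 0 0)
  rw [Finset.card_range] at h2
  rw [Nat.card_Ico] at h3
  have := Nat.one_le_two_pow (n := n + 1)
  rw [cut, pow_succ 2 (n + 1)]
  omega

theorem isSeparation_cut (n : ℕ) : IsSeparation graph (cutLeft n) (cutRight n) := by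
  refine ⟨?_, ?_⟩
  · rw [cutLeft, cutRight, Set.union_union_union_comm, Set.union_compl_self, Set.univ_union]
  · rintro a ⟨ha, ha'⟩ b ⟨hb, hb'⟩ hab
    simp only [cutLeft, cutRight, Set.mem_union, Set.mem_compl_iff, not_or, not_not] at ha' hb'
    obtain ⟨⟨ha1, ha2⟩, ha3⟩ := ha'
    obtain ⟨hb1, hb2⟩ := hb'
    simp only [Set.mem_ofPred_eq, not_and_or, not_le] at hb1
    simp only [cut, Finset.coe_union, Finset.coe_image, Set.mem_union, Set.mem_image,
      Finset.mem_coe, Finset.mem_range, Finset.mem_Ico, not_or, not_exists, not_and] at ha3 hb2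
    have hpow (i : ℕ) (hi : i ≤ n) : 2 ^ (i + 1) ≤ 2 ^ (n + 1) :=
      Nat.pow_le_pow_right (by norm_num) (by omega)
    rcases hab.2 with (h | ⟨h1, h2, m, c, h | h⟩) | (h | ⟨h1, h2, m, c, h | h⟩)
    · omega
    · obtain rfl : m = n := by omega
      refine ha3.1 c h.2.2.2.2 ?_
      rw [← h1, ← h.1, ← h.2.2.1, pt_part_row_col]
    · have := Nat.one_le_two_pow (n := m)
      refine hb2.2 c ⟨by omega, h.2.2.2.2.2.trans_le (hpow m (by omega))⟩ ?_
      rw [← pt_part_row_col b, h.2.1, h2, h.2.2.2.1]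
    · omega
    · omega
    · omega

theorem eventually_ray_notMem_cut (n p : ℕ) : ∀ᶠ k in Filter.atTop, ray p k ∉ cut n := by
  refine Filter.eventually_atTop.2 ⟨1, fun k hk h => ?_⟩
  simp only [cut, ray, Finset.mem_union, Finset.mem_image, pt_inj] at h
  grind

theorem eventually_ray_mem_cutLeft (n : ℕ) :
    ∀ᶠ k in Filter.atTop, ray (n + 1) k ∈ cutLeft n \ cutRight n := by
  filter_upwards [eventually_ray_notMem_cut n (n + 1)] with k hk
  simp [cutLeft, cutRight, hk]
  simp [ray]

theorem eventually_ray_mem_cutRight {n p : ℕ} (hp : p = 0 ∨ n + 1 < p) :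
    ∀ᶠ k in Filter.atTop, ray p k ∈ cutRight n \ cutLeft n := by
  filter_upwards [eventually_ray_notMem_cut n p] with k hk
  simp [cutLeft, cutRight, hk]
  simp [ray]
  omega

theorem not_rayEquiv_ray {n p : ℕ} (hp : p = 0 ∨ n + 1 < p) :
    ¬ RayEquiv graph (ray (n + 1)) (ray p) :=
  not_rayEquiv_of_isSeparation (isSeparation_cut n)
    (by rw [cutLeft_inter_cutRight]; exact (cut n).finite_toSet)
    (eventually_ray_mem_cutLeft n) (eventually_ray_mem_cutRight hp)

theorem sepSeparatesEnds_cut (n : ℕ) :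
    SepSeparatesEnds graph (cutLeft n) (cutRight n) (ray (n + 1)) (ray 0) := by
  refine Or.inl ⟨fun v hv => ?_, fun v hv => ?_⟩
  · exact (isSeparation_cut n).mem_diff_of_inEndComp (eventually_ray_mem_cutLeft n) hv
  · rw [Set.inter_comm] at hv
    exact (isSeparation_cut n).symm.mem_diff_of_inEndComp
      (eventually_ray_mem_cutRight (.inl rfl)) hv

end Cut

section LowerBound

/-- Vertices with the same label `c ∈ [1, 2 ^ (n + 2))` contain a path between the ends of
parts `n + 1` and `0`. -/
def label (n x : ℕ) : ℕ :=
  if part x = 0 then col x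
  else if part x ≤ n then col x / 2
  else if part x = n + 1 then
    if col x % 2 = 0 then col x / 2 else 2 ^ (n + 1) + col x / 2
  else if part x = n + 2 then
    if col x / 2 < 2 ^ (n + 1) then 2 ^ (n + 1) + col x / 2 else col x / 2
  else 0

variable {n c : ℕ} {X A B : Set ℕ}

theorem connAvoiding_descend (hX : ∀ x ∈ X, label n x ≠ c) {j : ℕ} (hj : j ≤ n)
    (hc : c < 2 ^ (j + 1)) :
    ConnAvoiding graph X (pt (n + 1) 0 (2 * c)) (pt (j + 1) 0 (2 * c)) := by
  have hl {i : ℕ} (hi : i ≤ n) : pt (i + 1) 0 (2 * c) ∉ X :=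
    fun h => hX _ h (by grind [label, part_pt, col_pt])
  have hr {i : ℕ} (hi : i < n) : pt (i + 1) 0 (2 * c + 1) ∉ X :=
    fun h => hX _ h (by grind [label, part_pt, col_pt])
  induction hj using Nat.decreasingInduction with
  | self => exact .refl (hl le_rfl)
  | of_succ i hi ih =>
    refine (ih (hc.trans_le (Nat.pow_le_pow_right (by norm_num) (by omega)))).trans
      (.trans (y := pt (i + 1) 0 (2 * c + 1)) ?_ ?_)
    · exact .of_adj (adj_next hc).symm (hl hi) (hr hi)
    · exact .of_adj (adj_of_level (by omega) (by omega) (by omega)) (hr hi) (hl hi.le)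

theorem inEndComp_zero (hfin : X.Finite) (hX : ∀ x ∈ X, label n x ≠ c) :
    InEndComp graph X (ray 0) (pt 0 0 c) :=
  inEndComp_column hfin fun k h => hX _ h (by simp [label])

theorem inEndComp_even (hfin : X.Finite) (hX : ∀ x ∈ X, label n x ≠ c) :
    InEndComp graph X (ray (n + 1)) (pt (n + 1) 0 (2 * c)) :=
  inEndComp_column hfin fun k h => hX _ h (by grind [label, part_pt, col_pt])

theorem exists_connAvoiding (hfin : X.Finite) (hX : ∀ x ∈ X, label n x ≠ c) (hc : 1 ≤ c)
    (hc' : c < 2 ^ (n + 2)) :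
    ∃ x, InEndComp graph X (ray (n + 1)) x ∧ ConnAvoiding graph X x (pt 0 0 c) := by
  have hz : pt 0 0 c ∉ X := fun h => hX _ h (by simp [label])
  rcases lt_or_ge c (2 ^ (n + 1)) with h | h
  · have hlog : Nat.log 2 c ≤ n := Nat.lt_succ_iff.1 (Nat.log_lt_of_lt_pow (by omega) h)
    have hlt : c < 2 ^ (Nat.log 2 c + 1) := Nat.lt_pow_succ_log_self (by norm_num) c
    have hdesc := connAvoiding_descend hX hlog hlt
    exact ⟨_, inEndComp_even hfin hX, hdesc.trans (.of_adj
      (adj_zero (Nat.pow_log_le_self 2 (by omega)) hlt) hdesc.right_notMem hz)⟩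
  · obtain ⟨d, rfl⟩ := Nat.exists_eq_add_of_le h
    have hd : d < 2 ^ (n + 1) := by rw [pow_succ 2 (n + 1)] at hc'; omega
    have h1 (k : ℕ) : pt (n + 1) k (2 * d + 1) ∉ X :=
      fun h => hX _ h (by grind [label, part_pt, col_pt])
    have h2 (k : ℕ) : pt (n + 2) k (2 * d) ∉ X :=
      fun h => hX _ h (by grind [label, part_pt, col_pt])
    have h3 : pt (n + 2) 0 (2 * (2 ^ (n + 1) + d)) ∉ X :=
      fun h => hX _ h (by grind [label, part_pt, col_pt])
    refine ⟨_, inEndComp_column hfin h1, .trans (.of_adj (adj_next hd) (h1 0) (h2 0)) ?_⟩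
    refine (connAvoiding_column h2 0 (2 * 2 ^ (n + 1))).trans (.trans (.of_adj ?_ (h2 _) h3)
      (.of_adj (adj_zero h hc') h3 hz))
    exact adj_of_level (by have := Nat.one_le_two_pow (n := n + 1); omega) (by omega) (by omega)

theorem exists_mem_label_eq (hs : IsSeparation graph A B) (hfin : (A ∩ B).Finite)
    (hA : ∀ v, InEndComp graph (A ∩ B) (ray (n + 1)) v → v ∈ A \ B)
    (hB : ∀ v, InEndComp graph (A ∩ B) (ray 0) v → v ∈ B \ A) (hc : 1 ≤ c)
    (hc' : c < 2 ^ (n + 2)) : ∃ x ∈ A ∩ B, label n x = c := by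
  by_contra! hX
  obtain ⟨x, hx, hxc⟩ := exists_connAvoiding hfin hX hc hc'
  exact not_connAvoiding_of_mem_diff hs (hA x hx) (hB _ (inEndComp_zero hfin hX)) hxc

theorem separation_of_encard_lt (hs : IsSeparation graph A B)
    (hA : ∀ v, InEndComp graph (A ∩ B) (ray (n + 1)) v → v ∈ A \ B)
    (hB : ∀ v, InEndComp graph (A ∩ B) (ray 0) v → v ∈ B \ A)
    (hlt : (A ∩ B).encard < (2 ^ (n + 2) : ℕ)) :
    (A ∩ B).ncard = 2 ^ (n + 2) - 1 ∧ pt 1 0 0 ∈ A \ B ∧ pt 0 0 0 ∈ B \ A := by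
  have hfin : (A ∩ B).Finite := Set.finite_of_encard_le_coe hlt.le
  have hlt' : (A ∩ B).ncard < 2 ^ (n + 2) := by
    rw [← hfin.cast_ncard_eq] at hlt
    exact_mod_cast hlt
  have hsub : Set.Ico 1 (2 ^ (n + 2)) ⊆ label n '' (A ∩ B) :=
    fun c hc => exists_mem_label_eq hs hfin hA hB hc.1 hc.2
  have hle := (Set.ncard_le_ncard hsub (hfin.image _)).trans (Set.ncard_image_le hfin)
  have hIco : (Set.Ico 1 (2 ^ (n + 2))).ncard = 2 ^ (n + 2) - 1 := by
    rw [← Finset.coe_Ico, Set.ncard_coe_finset, Nat.card_Ico]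
  have h0 : ∀ x ∈ A ∩ B, label n x ≠ 0 := by
    intro x hx hx0
    have hsub' : Set.Iio (2 ^ (n + 2)) ⊆ label n '' (A ∩ B) := by
      intro c hc
      rcases Nat.eq_zero_or_pos c with rfl | hpos
      · exact ⟨x, hx, hx0⟩
      · exact hsub ⟨hpos, hc⟩
    have hle' := (Set.ncard_le_ncard hsub' (hfin.image _)).trans (Set.ncard_image_le hfin)
    rw [← Finset.coe_Iio, Set.ncard_coe_finset, Nat.card_Iio] at hle'
    omega
  refine ⟨by omega, ?_, hB _ (inEndComp_zero hfin h0)⟩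
  exact hs.mem_diff_of_connAvoiding (connAvoiding_descend h0 (Nat.zero_le n) (by positivity))
    (hA _ (inEndComp_even hfin h0))

end LowerBound

theorem exists_mem_edges_path {M : Type v} {T : SimpleGraph M} (D : TreeDecomp graph T) {s t : M}
    (hs : pt 1 0 0 ∈ D.bag s) (ht : pt 0 0 0 ∈ D.bag t) {n : ℕ}
    (h : D.EffDistinguishesEnds (ray (n + 1)) (ray 0)) :
    ∃ a b, s(a, b) ∈ (D.path s t).edges ∧
      (D.sideSet a b ∩ D.sideSet b a).ncard = 2 ^ (n + 2) - 1 := by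
  obtain ⟨a, b, hab, hsep, hends, hmin⟩ := h
  have hlt : (D.sideSet a b ∩ D.sideSet b a).encard < (2 ^ (n + 2) : ℕ) := by
    refine (hmin _ _ (isSeparation_cut n) (sepSeparatesEnds_cut n)).trans_lt ?_
    rw [cutLeft_inter_cutRight, Set.encard_coe_eq_coe_finsetCard]
    exact_mod_cast card_cut_lt n
  rcases hends with ⟨hA, hB⟩ | ⟨hA, hB⟩
  · obtain ⟨hcard, hu, hv⟩ := separation_of_encard_lt hsep hA hB hlt
    exact ⟨a, b, D.mem_edges_path hab hu.2 hs hv.2 ht, hcard⟩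
  · rw [Set.inter_comm] at hA hB hlt
    obtain ⟨hcard, hu, hv⟩ := separation_of_encard_lt hsep.symm hA hB hlt
    exact ⟨b, a, D.mem_edges_path hab.symm hu.2 hs hv.2 ht, hcard⟩

theorem exists_not_effDistinguishesEnds {M : Type v} {T : SimpleGraph M}
    (D : TreeDecomp graph T) : ∃ n : ℕ, ¬ D.EffDistinguishesEnds (ray (n + 1)) (ray 0) := by
  by_contra! h
  obtain ⟨s, hs⟩ := D.bag_cover (pt 1 0 0)
  obtain ⟨t, ht⟩ := D.bag_cover (pt 0 0 0)
  choose a b hmem hcard using fun n => exists_mem_edges_path D hs ht (h n)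
  have hinj : Function.Injective fun n => s(a n, b n) := by
    intro n m hnm
    have heq : 2 ^ (n + 2) - 1 = 2 ^ (m + 2) - 1 := by
      rw [← hcard n, ← hcard m]
      rcases Sym2.eq_iff.1 hnm with ⟨h1, h2⟩ | ⟨h1, h2⟩
      · rw [h1, h2]
      · rw [h1, h2, Set.inter_comm]
    have h1 := Nat.one_le_two_pow (n := n + 2)
    have h2 := Nat.one_le_two_pow (n := m + 2)
    have := Nat.pow_right_injective le_rfl (show 2 ^ (n + 2) = 2 ^ (m + 2) by omega)
    omega
  exact Set.infinite_of_injective_forall_mem (s := {e | e ∈ (D.path s t).edges}) hinj hmem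
    (List.finite_toSet _)

end BlobGraph

/-- There exist a locally finite connected graph `G`, an end `ε` of `G` and
pairwise distinct ends `ε_n` (n ∈ ℕ), each distinct from `ε`, such that every
tree-decomposition of `G` fails to distinguish some `ε_n` from `ε` efficiently. -/
theorem statement_8 :
    ∃ (G : SimpleGraph ℕ) (ε : ℕ → ℕ) (εn : ℕ → ℕ → ℕ),
      LocFin G ∧ G.Connected ∧ IsRay G ε ∧ (∀ n : ℕ, IsRay G (εn n)) ∧
      (∀ n : ℕ, ¬ RayEquiv G (εn n) ε) ∧
      (Pairwise fun n m => ¬ RayEquiv G (εn n) (εn m)) ∧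
      ∀ (M : Type v) (T : SimpleGraph M) (D : TreeDecomp G T),
        ∃ n : ℕ, ¬ D.EffDistinguishesEnds (εn n) ε := by
  refine ⟨BlobGraph.graph, BlobGraph.ray 0, fun n => BlobGraph.ray (n + 1),
    BlobGraph.locFin_graph, BlobGraph.connected_graph, BlobGraph.isRay_ray 0,
    fun n => BlobGraph.isRay_ray (n + 1), fun n => BlobGraph.not_rayEquiv_ray (.inl rfl),
    fun n m hnm => ?_, fun M T D => BlobGraph.exists_not_effDistinguishesEnds D⟩
  rcases lt_or_gt_of_ne hnm with h | h
  · exact BlobGraph.not_rayEquiv_ray (.inr (by omega))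
  · exact fun he => BlobGraph.not_rayEquiv_ray (.inr (by omega)) he.symm
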